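/- arXiv:1701.04180 — 2 statements merged into one kernel-verified Lean document; each statement's English description precedes it below -/
import Mathlib

section
/- Let C be a Type II self-dual additive (10,2^10) code over GF(4) of minimum weight 4. Then ρ_C(C) = Ĉ + (d_4^{10})_0 + e_C is a singly-even self-dual binary [40,20,8] code: it has 𝔽₂-dimension 20, equals its dual under the standard inner product on 𝔽₂^40, every codeword has even weight, some codeword has weight ≡ 2 (mod 4), and its minimum nonzero Hamming weight is 8. -/
open scoped BigOperators

section Defs

variable {F : Type} [Field F] [DecidableEq F]

/-- The binary coordinate in column `j` (0-indexed), row `k`. -/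
def idx (j : Fin 10) (k : Fin 4) : Fin 40 :=
  ⟨4 * j.val + k.val, by have := j.isLt; have := k.isLt; omega⟩

/-- The map φ : GF(4) → 𝔽₂⁴, 0↦0000, 1↦0011, ω↦0101, ϖ↦0110. -/
def phi (ω : F) : F → (Fin 4 → ZMod 2) := fun x =>
  if x = 0 then ![0, 0, 0, 0]
  else if x = 1 then ![0, 0, 1, 1]
  else if x = ω then ![0, 1, 0, 1]
  else ![0, 1, 1, 0]

/-- Ĉ : the image of a quaternary code under coordinatewise φ. -/
def hatSet (ω : F) (C : Set (Fin 10 → F)) : Set (Fin 40 → ZMod 2) :=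
  { v | ∃ c ∈ C, ∀ (j : Fin 10) (k : Fin 4), v (idx j k) = phi ω (c j) k }

/-- d₄¹⁰ : binary vectors of length 40 constant on each of the ten columns. -/
def d4ten : Set (Fin 40 → ZMod 2) :=
  { v | ∀ (j : Fin 10) (k k' : Fin 4), v (idx j k) = v (idx j k') }

/-- (d₄¹⁰)₀ : the subcode of d₄¹⁰ of codewords of weight divisible by 8. -/
def d4ten0 : Set (Fin 40 → ZMod 2) :=
  { v | v ∈ d4ten ∧ 8 ∣ hammingNorm v }

/-- The generator 1000 1000 ... 1000 of e_C. -/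
def eCvec : Fin 40 → ZMod 2 := fun i => if i.val % 4 = 0 then 1 else 0

/-- The generator 1000 (×9) 0111 of e_B. -/
def eBvec : Fin 40 → ZMod 2 := fun i =>
  if i.val < 36 then (if i.val % 4 = 0 then 1 else 0)
  else (if i.val % 4 = 0 then 0 else 1)

/-- ρ_C(C) = Ĉ + (d₄¹⁰)₀ + e_C. -/
def rhoC (ω : F) (C : Set (Fin 10 → F)) : Set (Fin 40 → ZMod 2) :=
  { v | ∃ a ∈ hatSet ω C, ∃ b ∈ d4ten0,
      ∃ e ∈ ({0, eCvec} : Set (Fin 40 → ZMod 2)), v = a + b + e }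

/-- ρ_B(C) = Ĉ + (d₄¹⁰)₀ + e_B. -/
def rhoB (ω : F) (C : Set (Fin 10 → F)) : Set (Fin 40 → ZMod 2) :=
  { v | ∃ a ∈ hatSet ω C, ∃ b ∈ d4ten0,
      ∃ e ∈ ({0, eBvec} : Set (Fin 40 → ZMod 2)), v = a + b + e }

/-- The trace inner product x⋆y = Σ Tr(xᵢ ȳᵢ), computed in GF(4) (its value lies
in the prime subfield GF(2)). -/
def traceIP (x y : Fin 10 → F) : F :=
  ∑ i, ((x i * (y i) ^ 2) + (x i * (y i) ^ 2) ^ 2)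

/-- The dual of an additive code with respect to the trace inner product. -/
def addDual (C : Set (Fin 10 → F)) : Set (Fin 10 → F) :=
  { x | ∀ c ∈ C, traceIP x c = 0 }

/-- The dual of a binary code of length 40 under the standard inner product. -/
def binDual (S : Set (Fin 40 → ZMod 2)) : Set (Fin 40 → ZMod 2) :=
  { x | ∀ c ∈ S, ∑ i, x i * c i = 0 }

/-- The dual of a quaternary code under the Hermitian inner product ⟨x,y⟩ = Σ xᵢ ȳᵢ. -/
def hermDual (S : Set (Fin 10 → F)) : Set (Fin 10 → F) :=
  { x | ∀ c ∈ S, ∑ i, x i * (c i) ^ 2 = 0 }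

/-- The Hermitian self-dual [10,5,4] code E₁₀ over GF(4). -/
def E10 (ω : F) : Submodule F (Fin 10 → F) :=
  Submodule.span F {![1,1,1,1,0,0,0,0,0,0], ![0,0,1,1,1,1,0,0,0,0],
    ![0,0,0,0,1,1,1,1,0,0], ![0,0,0,0,0,0,1,1,1,1],
    ![1,0,1,0,1,0,1,0,ω,ω^2]}

/-- The Hermitian self-dual [10,5,4] code B₁₀ over GF(4). -/
def B10 (ω : F) : Submodule F (Fin 10 → F) :=
  Submodule.span F {![1,1,1,1,0,0,0,0,0,0], ![0,1,ω,ω^2,1,0,0,0,0,0],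
    ![0,0,0,0,0,1,1,1,1,0], ![0,0,0,0,0,0,1,ω,ω^2,1],
    ![0,1,ω^2,ω,0,0,1,ω^2,ω,0]}

/-- Interpret a bit as an element of GF(4). -/
def b2f (x : ZMod 2) : F := if x = 1 then 1 else 0

/-- The projection 𝔽₂⁴⁰ → GF(4)¹⁰ : column j ↦ v₂ᵢₙ·1 + v·ω + v·ϖ with row labels 0,1,ω,ϖ. -/
def Proj (ω : F) (v : Fin 40 → ZMod 2) : Fin 10 → F := fun j =>
  b2f (v (idx j 1)) * 1 + b2f (v (idx j 2)) * ω + b2f (v (idx j 3)) * ω ^ 2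

/-- The parity of column j (1 = odd number of ones). -/
def colPar (v : Fin 40 → ZMod 2) (j : Fin 10) : ZMod 2 := ∑ k, v (idx j k)

/-- The parity of the top row (1 = odd number of ones). -/
def topPar (v : Fin 40 → ZMod 2) : ZMod 2 := ∑ j, v (idx j 0)

/-- The coordinate permutation of Fin 10 permuting the five blocks {2m, 2m+1}
as units according to π, preserving order within blocks. -/
def blockPerm (π : Equiv.Perm (Fin 5)) : Fin 10 → Fin 10 := fun t =>
  ⟨2 * (π ⟨t.val / 2, by have := t.isLt; omega⟩).val + t.val % 2, by
    have := (π ⟨t.val / 2, by have := t.isLt; omega⟩).isLt; have := t.isLt; omega⟩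

/-- The coordinate permutation of Fin 10 interchanging the two coordinates within
each block belonging to S, fixing all other coordinates. -/
def blockSwap (S : Finset (Fin 5)) : Fin 10 → Fin 10 := fun t =>
  if (⟨t.val / 2, by have := t.isLt; omega⟩ : Fin 5) ∈ S then
    ⟨2 * (t.val / 2) + (1 - t.val % 2), by have := t.isLt; omega⟩
  else t

end Defs

/-- A sum over the 40 coordinates, computed column by column. -/
lemma sum_eq_sum_idx {M : Type} [AddCommMonoid M] (f : Fin 40 → M) :
    ∑ i, f i = ∑ j, ∑ k, f (idx j k) := by
  rw [← Fintype.sum_prod_type' (fun j k => f (idx j k))]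
  refine (Fintype.sum_equiv (finProdFinEquiv : Fin 10 × Fin 4 ≃ Fin 40) _ _ fun p => ?_).symm
  congr 1
  ext
  simp [idx, finProdFinEquiv, add_comm]

lemma exists_eq_idx (i : Fin 40) : ∃ j k, i = idx j k :=
  ⟨⟨i / 4, by omega⟩, ⟨i % 4, by omega⟩, by ext; simp only [idx]; omega⟩

lemma eq_of_forall_idx {v w : Fin 40 → ZMod 2} (h : ∀ j k, v (idx j k) = w (idx j k)) :
    v = w := by
  funext i
  obtain ⟨j, k, rfl⟩ := exists_eq_idx i
  exact h j k

/-- A binary vector of length 40 with prescribed entries in each column. -/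
lemma exists_forall_idx (f : Fin 10 → Fin 4 → ZMod 2) :
    ∃ v : Fin 40 → ZMod 2, ∀ j k, v (idx j k) = f j k := by
  refine ⟨fun i => f ⟨i / 4, by omega⟩ ⟨i % 4, by omega⟩, fun j k => ?_⟩
  have hj (h : (idx j k : ℕ) / 4 < 10) : (⟨(idx j k : ℕ) / 4, h⟩ : Fin 10) = j := by
    ext
    simp only [idx]
    omega
  have hk (h : (idx j k : ℕ) % 4 < 4) : (⟨(idx j k : ℕ) % 4, h⟩ : Fin 4) = k := by
    ext
    simp only [idx]
    omega
  simp only [hj, hk]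

lemma hammingNorm_eq_sum {ι α : Type} [Fintype ι] [Zero α] [DecidableEq α] (v : ι → α) :
    hammingNorm v = ∑ i, if v i = 0 then 0 else 1 := by
  simp [hammingNorm, Finset.card_filter, ite_not]

lemma natCast_hammingNorm {ι : Type} [Fintype ι] (v : ι → ZMod 2) :
    (hammingNorm v : ZMod 2) = ∑ i, v i := by
  rw [hammingNorm_eq_sum, Nat.cast_sum]
  refine Finset.sum_congr rfl fun i _ => ?_
  generalize v i = x
  revert x
  decide

lemma hammingNorm_eq_sum_columns (v : Fin 40 → ZMod 2) :
    hammingNorm v = ∑ j, hammingNorm fun k => v (idx j k) := by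
  simp only [hammingNorm_eq_sum]
  exact sum_eq_sum_idx fun i => if v i = 0 then 0 else 1

lemma even_hammingNorm_of_sum_mul_self {ι : Type} [Fintype ι] {v : ι → ZMod 2}
    (h : ∑ i, v i * v i = 0) : Even (hammingNorm v) := by
  rw [← ZMod.natCast_eq_zero_iff_even, natCast_hammingNorm, ← h]
  refine Finset.sum_congr rfl fun i _ => ?_
  generalize v i = x
  revert x
  decide

lemma mem_d4ten0_iff {v : Fin 40 → ZMod 2} :
    v ∈ d4ten0 ↔ ∃ d : Fin 10 → ZMod 2, ∑ j, d j = 0 ∧ ∀ j k, v (idx j k) = d j := by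
  have key (d : Fin 10 → ZMod 2) (h : ∀ j k, v (idx j k) = d j) :
      8 ∣ hammingNorm v ↔ ∑ j, d j = 0 := by
    have hv : hammingNorm v = 4 * hammingNorm d := by
      rw [hammingNorm_eq_sum_columns, hammingNorm_eq_sum d, Finset.mul_sum]
      refine Finset.sum_congr rfl fun j _ => ?_
      simp [h, hammingNorm_eq_sum]
    rw [hv, ← natCast_hammingNorm, ZMod.natCast_eq_zero_iff]
    omega
  constructor
  · rintro ⟨hc, h8⟩
    have h (j : Fin 10) (k : Fin 4) : v (idx j k) = v (idx j 0) := hc j k 0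
    exact ⟨fun j => v (idx j 0), (key _ h).1 h8, h⟩
  · rintro ⟨d, hd, h⟩
    exact ⟨fun j k k' => by rw [h, h], (key d h).2 hd⟩

lemma eCvec_idx (j : Fin 10) (k : Fin 4) : eCvec (idx j k) = if k = 0 then 1 else 0 := by
  simp only [eCvec, idx, Fin.ext_iff]
  congr 1
  simp only [Fin.val_zero, eq_iff_iff]
  omega

lemma charP_two_of_card_eq_four {F : Type} [Field F] [Fintype F] (hF : Fintype.card F = 4) :
    CharP F 2 := by
  have h4 : ((4 : ℕ) : F) = 0 := hF ▸ Nat.cast_card_eq_zero F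
  have h2 : (2 : F) = 0 := by
    have : (2 : F) * 2 = 0 := by
      rw [← h4]
      norm_num
    simpa using this
  exact CharTwo.of_one_ne_zero_of_two_eq_zero one_ne_zero h2

section Quaternary

variable {F : Type} [Field F] [DecidableEq F] {ω : F}

@[simp]
lemma phi_zero (ω : F) : phi ω 0 = 0 := by
  simp only [phi, if_true]
  decide

@[simp]
lemma phi_apply_zero (ω x : F) : phi ω x 0 = 0 := by
  unfold phi
  split_ifs <;> rfl

@[simp]
lemma sum_phi (ω x : F) : ∑ k, phi ω x k = 0 := by
  unfold phi
  split_ifs <;> decide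

lemma hammingNorm_phi (ω x : F) : hammingNorm (phi ω x) = if x = 0 then 0 else 2 := by
  unfold phi
  split_ifs <;> decide

/-- Membership in `rhoC` expressed through the entries of the columns. -/
lemma mem_rhoC_iff {C : Set (Fin 10 → F)} {v : Fin 40 → ZMod 2} :
    v ∈ rhoC ω C ↔ ∃ c ∈ C, ∃ d : Fin 10 → ZMod 2, ∃ ε : ZMod 2, ∑ j, d j = 0 ∧
      ∀ j k, v (idx j k) = phi ω (c j) k + d j + if k = 0 then ε else 0 := by
  constructor
  · rintro ⟨a, ⟨c, hc, ha⟩, b, hb, e, he, rfl⟩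
    obtain ⟨d, hd, hb⟩ := mem_d4ten0_iff.1 hb
    rcases he with rfl | rfl
    · exact ⟨c, hc, d, 0, hd, fun j k => by simp [ha, hb]⟩
    · exact ⟨c, hc, d, 1, hd, fun j k => by simp [ha, hb, eCvec_idx]⟩
  · rintro ⟨c, hc, d, ε, hd, hv⟩
    obtain ⟨a, ha⟩ := exists_forall_idx fun j k => phi ω (c j) k
    obtain ⟨b, hb⟩ := exists_forall_idx fun j _ => d j
    refine ⟨a, ⟨c, hc, ha⟩, b, mem_d4ten0_iff.2 ⟨d, hd, hb⟩, ?_⟩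
    rcases (by decide : ∀ t : ZMod 2, t = 0 ∨ t = 1) ε with rfl | rfl
    · exact ⟨0, by simp, eq_of_forall_idx fun j k => by simp [ha, hb, hv]⟩
    · exact ⟨eCvec, by simp, eq_of_forall_idx fun j k => by simp [ha, hb, hv, eCvec_idx]⟩

lemma sum_column_mul (ω x y : F) (d d' ε ε' : ZMod 2) :
    ∑ k, (phi ω x k + d + if k = 0 then ε else 0) * (phi ω y k + d' + if k = 0 then ε' else 0) =
      ∑ k, phi ω x k * phi ω y k + (ε * d' + ε' * d + ε * ε') := by
  have hx := sum_phi ω x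
  have hy := sum_phi ω y
  have h4 : (4 : ZMod 2) = 0 := rfl
  simp only [Fin.sum_univ_four, phi_apply_zero] at hx hy ⊢
  simp
  linear_combination d' * hx + d * hy + d * d' * h4

/-- If two vectors are in the column form of `rhoC`, their inner product reduces to that of
the images of the quaternary words. -/
lemma sum_mul_of_columns {c c' : Fin 10 → F} {d d' : Fin 10 → ZMod 2} {ε ε' : ZMod 2}
    {v v' : Fin 40 → ZMod 2}
    (hv : ∀ j k, v (idx j k) = phi ω (c j) k + d j + if k = 0 then ε else 0)
    (hv' : ∀ j k, v' (idx j k) = phi ω (c' j) k + d' j + if k = 0 then ε' else 0) :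
    ∑ i, v i * v' i = ∑ j, ∑ k, phi ω (c j) k * phi ω (c' j) k +
      (ε * ∑ j, d' j + ε' * ∑ j, d j) := by
  have h10 : (10 : ZMod 2) = 0 := rfl
  rw [sum_eq_sum_idx]
  simp only [hv, hv', sum_column_mul, Finset.sum_add_distrib, Finset.mul_sum]
  simp [h10]

/-- The elements of a field with four elements. -/
lemma eq_cases_of_card_eq_four [Fintype F] [CharP F 2] (hF : Fintype.card F = 4)
    (hω : ω ^ 2 = ω + 1) :
    ω ≠ 0 ∧ ω ≠ 1 ∧ ω + 1 ≠ 0 ∧ ∀ x : F, x = 0 ∨ x = 1 ∨ x = ω ∨ x = ω + 1 := by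
  have h2 : (2 : F) = 0 := CharTwo.two_eq_zero
  have h0 : ω ≠ 0 := by
    rintro rfl
    simp at hω
  have h1 : ω ≠ 1 := by
    rintro rfl
    have : (1 : F) = 0 := by linear_combination hω + h2
    exact one_ne_zero this
  have h3 : ω + 1 ≠ 0 := by
    rw [← hω]
    exact pow_ne_zero 2 h0
  refine ⟨h0, h1, h3, fun x => ?_⟩
  have hcard : ({0, 1, ω, ω + 1} : Finset F).card = Fintype.card F := by
    rw [hF, Finset.card_insert_of_notMem, Finset.card_insert_of_notMem,
      Finset.card_insert_of_notMem, Finset.card_singleton]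
    · simp
    · simp [h0, h1.symm]
    · simp [h0.symm, h3.symm]
  have hx := Finset.mem_univ x
  rw [← Finset.eq_univ_of_card _ hcard] at hx
  simpa using hx

lemma sum_phi_mul [Fintype F] [CharP F 2] (hF : Fintype.card F = 4) (hω : ω ^ 2 = ω + 1)
    (x y : F) :
    ∑ k, phi ω x k * phi ω y k = if x = 0 ∨ y = 0 ∨ x = y then 0 else 1 := by
  obtain ⟨h0, h1, h2, h⟩ := eq_cases_of_card_eq_four hF hω
  have h11 : (1 + 1 : ZMod 2) = 0 := rfl
  rcases h x with rfl | rfl | rfl | rfl <;> rcases h y with rfl | rfl | rfl | rfl <;>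
    simp [phi, Fin.sum_univ_four, h0, h1, h2, h1.symm, h11]

lemma trace_mul_sq [Fintype F] [CharP F 2] (hF : Fintype.card F = 4) (x y : F) :
    x * y ^ 2 + (x * y ^ 2) ^ 2 = if x = 0 ∨ y = 0 ∨ x = y then 0 else 1 := by
  have h2 : (2 : F) = 0 := CharTwo.two_eq_zero
  have h3 {z : F} (hz : z ≠ 0) : z ^ 3 = 1 := by
    simpa [hF] using FiniteField.pow_card_sub_one_eq_one z hz
  split_ifs with h
  · rcases h with rfl | rfl | rfl
    · simp
    · simp
    · by_cases hx : x = 0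
      · simp [hx]
      · have h1 : x * x ^ 2 = 1 := by
          rw [← h3 hx]
          ring
        rw [h1]
        linear_combination h2
  · push Not at h
    obtain ⟨hx, hy, hxy⟩ := h
    have ht := h3 (mul_ne_zero hx (pow_ne_zero 2 hy))
    have ht1 : x * y ^ 2 - 1 ≠ 0 := fun h => hxy (by linear_combination y * h - x * h3 hy)
    have : (x * y ^ 2 - 1) * ((x * y ^ 2) ^ 2 + x * y ^ 2 + 1) = 0 := by
      linear_combination ht
    linear_combination (mul_eq_zero.1 this).resolve_left ht1 - h2

/-- The map `phi` turns the trace inner product into the standard one. -/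
lemma cast_sum_phi_mul [Fintype F] [CharP F 2] (hF : Fintype.card F = 4) (hω : ω ^ 2 = ω + 1)
    (x y : F) :
    ZMod.castHom dvd_rfl F (∑ k, phi ω x k * phi ω y k) =
      x * y ^ 2 + (x * y ^ 2) ^ 2 := by
  rw [sum_phi_mul hF hω, trace_mul_sq hF, apply_ite (ZMod.castHom dvd_rfl F), map_zero, map_one]

/-- The image of `phi` consists of the even vectors vanishing in the first entry. -/
lemma exists_phi_eq [Fintype F] [CharP F 2] (hF : Fintype.card F = 4) (hω : ω ^ 2 = ω + 1)
    (g : Fin 4 → ZMod 2) (h0 : g 0 = 0) (hg : ∑ k, g k = 0) : ∃ x, phi ω x = g := by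
  obtain ⟨hω0, hω1, hω2, -⟩ := eq_cases_of_card_eq_four hF hω
  have h : g = ![0, 0, 0, 0] ∨ g = ![0, 0, 1, 1] ∨ g = ![0, 1, 0, 1] ∨ g = ![0, 1, 1, 0] := by
    revert g
    decide
  rcases h with rfl | rfl | rfl | rfl
  · exact ⟨0, by simp [phi]⟩
  · exact ⟨1, by simp [phi]⟩
  · exact ⟨ω, by simp [phi, hω0, hω1]⟩
  · exact ⟨ω + 1, by simp [phi, hω0, hω2]⟩

/-- Every binary vector of length 4 is of the form of a column of a word of `rhoC`. -/
lemma exists_column_eq [Fintype F] [CharP F 2] (hF : Fintype.card F = 4) (hω : ω ^ 2 = ω + 1)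
    (f : Fin 4 → ZMod 2) :
    ∃ x d, ∀ k, f k = phi ω x k + d + if k = 0 then ∑ l, f l else 0 := by
  set s := ∑ l, f l with hs
  have h4 : (4 : ZMod 2) = 0 := rfl
  have h2 : (2 : ZMod 2) = 0 := rfl
  obtain ⟨x, hx⟩ := exists_phi_eq hF hω
    (fun k => f k + (f 0 + s) + if k = 0 then s else 0)
    (by simp only [if_true]; linear_combination (f 0 + s) * h2)
    (by
      simp only [Finset.sum_add_distrib, ← hs]
      simp
      linear_combination s * h2 + (f 0 + s) * h4)
  refine ⟨x, f 0 + s, fun k => ?_⟩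
  rw [hx]
  linear_combination -(f 0 + s + if k = 0 then s else 0) * h2

/-- The images of two quaternary words are orthogonal exactly when the words are orthogonal
for the trace inner product. -/
lemma sum_phi_mul_eq_zero_iff [Fintype F] (hF : Fintype.card F = 4) (hω : ω ^ 2 = ω + 1)
    (c c' : Fin 10 → F) :
    ∑ j, ∑ k, phi ω (c j) k * phi ω (c' j) k = 0 ↔ traceIP c c' = 0 := by
  have := charP_two_of_card_eq_four hF
  have h : traceIP c c' =
      ZMod.castHom dvd_rfl F (∑ j, ∑ k, phi ω (c j) k * phi ω (c' j) k) := by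
    rw [map_sum]
    exact Finset.sum_congr rfl fun j _ => (cast_sum_phi_mul hF hω _ _).symm
  rw [h, map_eq_zero]

lemma rhoC_subset_binDual [Fintype F] (hF : Fintype.card F = 4) (hω : ω ^ 2 = ω + 1)
    {C : Set (Fin 10 → F)} (hC : C ⊆ addDual C) : rhoC ω C ⊆ binDual (rhoC ω C) := by
  intro v hv v' hv'
  obtain ⟨c, hc, d, ε, hd, hv⟩ := mem_rhoC_iff.1 hv
  obtain ⟨c', hc', d', ε', hd', hv'⟩ := mem_rhoC_iff.1 hv'
  rw [sum_mul_of_columns hv hv', hd, hd',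
    (sum_phi_mul_eq_zero_iff hF hω c c').2 (hC hc c' hc')]
  simp

/-- A vector orthogonal to `d4ten0` has columns of equal parity. -/
lemma sum_column_eq_of_mem_binDual {S : Set (Fin 40 → ZMod 2)} (hS : d4ten0 ⊆ S)
    {v : Fin 40 → ZMod 2} (hv : v ∈ binDual S) (j j' : Fin 10) :
    ∑ k, v (idx j k) = ∑ k, v (idx j' k) := by
  obtain ⟨b, hb⟩ := exists_forall_idx fun l _ =>
    (Pi.single j 1 + Pi.single j' 1 : Fin 10 → ZMod 2) l
  have h2 : (1 + 1 : ZMod 2) = 0 := rfl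
  have h := hv b (hS (mem_d4ten0_iff.2 ⟨_, by simp [Finset.sum_add_distrib, h2], hb⟩))
  rw [sum_eq_sum_idx] at h
  simp only [hb, ← Finset.sum_mul, Pi.add_apply, mul_add, Finset.sum_add_distrib] at h
  simp only [Pi.single_apply, mul_ite, mul_one, mul_zero, Finset.sum_ite_eq', Finset.mem_univ,
    if_true] at h
  exact CharTwo.add_eq_zero.1 h

lemma binDual_subset_rhoC [Fintype F] (hF : Fintype.card F = 4) (hω : ω ^ 2 = ω + 1)
    {C : Set (Fin 10 → F)} (h0 : 0 ∈ C) (hC : addDual C ⊆ C) :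
    binDual (rhoC ω C) ⊆ rhoC ω C := by
  have := charP_two_of_card_eq_four hF
  intro v hv
  have hd4 : d4ten0 ⊆ rhoC ω C := fun b hb => by
    obtain ⟨d, hd, hb⟩ := mem_d4ten0_iff.1 hb
    exact mem_rhoC_iff.2 ⟨0, h0, d, 0, hd, fun j k => by simp [hb]⟩
  choose c d hcd using fun j => exists_column_eq hF hω fun k => v (idx j k)
  have hcol (j : Fin 10) (k : Fin 4) : v (idx j k) =
      phi ω (c j) k + d j + if k = 0 then ∑ l, v (idx 0 l) else 0 := by
    rw [← sum_column_eq_of_mem_binDual hd4 hv j 0]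
    exact hcd j k
  refine mem_rhoC_iff.2 ⟨c, hC fun c' hc' => ?_, d, _, ?_, hcol⟩
  · obtain ⟨a, ha⟩ := exists_forall_idx fun j k => phi ω (c' j) k
    have ha' (j : Fin 10) (k : Fin 4) : a (idx j k) =
        phi ω (c' j) k + (0 : Fin 10 → ZMod 2) j + if k = 0 then 0 else 0 := by simp [ha]
    have h := hv a (mem_rhoC_iff.2 ⟨c', hc', 0, 0, by simp, ha'⟩)
    rw [sum_mul_of_columns hcol ha'] at h
    exact (sum_phi_mul_eq_zero_iff hF hω c c').1 (by simpa using h)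
  · have he (j : Fin 10) (k : Fin 4) : eCvec (idx j k) =
        phi ω ((0 : Fin 10 → F) j) k + (0 : Fin 10 → ZMod 2) j + if k = 0 then 1 else 0 := by
      simp [eCvec_idx]
    have h := hv eCvec (mem_rhoC_iff.2 ⟨0, h0, 0, 1, by simp, he⟩)
    rw [sum_mul_of_columns hcol he] at h
    simpa using h

lemma eight_le_hammingNorm_of_mem_rhoC {C : Set (Fin 10 → F)}
    (hC : ∀ c ∈ C, c ≠ 0 → 4 ≤ hammingNorm c) {v : Fin 40 → ZMod 2} (hv : v ∈ rhoC ω C)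
    (hv0 : v ≠ 0) : 8 ≤ hammingNorm v := by
  obtain ⟨c, hc, d, ε, hd, hv⟩ := mem_rhoC_iff.1 hv
  rcases (by decide : ∀ t : ZMod 2, t = 0 ∨ t = 1) ε with rfl | rfl
  · by_cases hc0 : c = 0
    · subst hc0
      have h8 := (mem_d4ten0_iff.2 ⟨d, hd, fun j k => by simp [hv]⟩ : v ∈ d4ten0).2
      exact Nat.le_of_dvd (hammingNorm_pos_iff.2 hv0) h8
    · have hcol (j : Fin 10) :
          2 * (if c j = 0 then 0 else 1) ≤ hammingNorm fun k => v (idx j k) := by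
        simp only [hv]
        generalize d j = t
        unfold phi
        split_ifs <;> revert t <;> decide
      have h := Finset.sum_le_sum fun j (_ : j ∈ Finset.univ) => hcol j
      rw [← hammingNorm_eq_sum_columns, ← Finset.mul_sum, ← hammingNorm_eq_sum] at h
      have := hC c hc hc0
      omega
  · have hcol (j : Fin 10) : 1 ≤ hammingNorm fun k => v (idx j k) := by
      simp only [hv]
      generalize d j = t
      unfold phi
      split_ifs <;> revert t <;> decide
    have h := Finset.sum_le_sum fun j (_ : j ∈ Finset.univ) => hcol j
    rw [← hammingNorm_eq_sum_columns] at h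
    simp at h
    omega

end Quaternary

/-- The dual of a binary code as a subspace. -/
def binDualSubmodule (S : Set (Fin 40 → ZMod 2)) : Submodule (ZMod 2) (Fin 40 → ZMod 2) where
  carrier := binDual S
  zero_mem' := fun c _ => by simp
  add_mem' := fun {x y} hx hy c hc => by
    simp [add_mul, Finset.sum_add_distrib, hx c hc, hy c hc]
  smul_mem' := fun t x hx c hc => by
    simp [mul_assoc, ← Finset.mul_sum, hx c hc]

lemma span_eq_of_eq_binDual {S : Set (Fin 40 → ZMod 2)} (hS : S = binDual S) :
    Submodule.span (ZMod 2) S = binDualSubmodule S := by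
  conv_lhs => rw [hS]
  exact Submodule.span_eq (binDualSubmodule S)

/-- A self-dual binary code of length 40 has dimension 20. -/
lemma finrank_span_of_eq_binDual {S : Set (Fin 40 → ZMod 2)} (hS : S = binDual S) :
    Module.finrank (ZMod 2) (Submodule.span (ZMod 2) S) = 20 := by
  let B : LinearMap.BilinForm (ZMod 2) (Fin 40 → ZMod 2) := dotProductBilin (ZMod 2) (ZMod 2)
  have hB : B.Nondegenerate :=
    ⟨fun x h => dotProduct_eq_zero x h, fun x h => dotProduct_eq_zero x fun y => by
      simpa [B, dotProduct_comm] using h y⟩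
  have horth : B.orthogonal (Submodule.span (ZMod 2) S) = Submodule.span (ZMod 2) S := by
    rw [span_eq_of_eq_binDual hS]
    ext x
    rw [LinearMap.BilinForm.mem_orthogonal_iff]
    change (∀ n ∈ binDual S, n ⬝ᵥ x = 0) ↔ x ∈ binDual S
    rw [← hS]
    conv_rhs => rw [hS]
    simp only [dotProduct_comm _ x]
    rfl
  have h := LinearMap.BilinForm.finrank_orthogonal hB (Submodule.span (ZMod 2) S)
  rw [horth] at h
  simp at h
  omega

/-- If C is a Type II self-dual additive (10,2¹⁰) code over GF(4) of
minimum weight 4, then ρ_C(C) is a singly-even self-dual binary [40,20,8] code. -/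
theorem stmt_0 (F : Type) [Field F] [Fintype F] [DecidableEq F]
    (hF : Fintype.card F = 4) (ω : F) (hω : ω ^ 2 = ω + 1)
    (C : Set (Fin 10 → F))
    (hzero : (0 : Fin 10 → F) ∈ C)
    (hadd : ∀ u ∈ C, ∀ v ∈ C, u + v ∈ C)
    (hcard : Nat.card C = 2 ^ 10)
    (hsd : C = addDual C)
    (hII : ∀ v ∈ C, Even (hammingNorm v))
    (hminlb : ∀ v ∈ C, v ≠ 0 → 4 ≤ hammingNorm v)
    (hminex : ∃ v ∈ C, hammingNorm v = 4) :
    ((Submodule.span (ZMod 2) (rhoC ω C) : Set (Fin 40 → ZMod 2)) = rhoC ω C ∧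
      Module.finrank (ZMod 2) (Submodule.span (ZMod 2) (rhoC ω C)) = 20) ∧
    rhoC ω C = binDual (rhoC ω C) ∧
    (∀ v ∈ rhoC ω C, Even (hammingNorm v)) ∧
    (∃ v ∈ rhoC ω C, hammingNorm v % 4 = 2) ∧
    (∀ v ∈ rhoC ω C, v ≠ 0 → 8 ≤ hammingNorm v) ∧
    (∃ v ∈ rhoC ω C, hammingNorm v = 8) := by
  have hdual : rhoC ω C = binDual (rhoC ω C) :=
    (rhoC_subset_binDual hF hω hsd.subset).antisymm (binDual_subset_rhoC hF hω hzero hsd.superset)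
  refine ⟨⟨?_, finrank_span_of_eq_binDual hdual⟩, hdual, fun v hv => ?_, ⟨eCvec, ?_, ?_⟩,
    fun v hv => eight_le_hammingNorm_of_mem_rhoC hminlb hv, ?_⟩
  · rw [span_eq_of_eq_binDual hdual]
    exact hdual.symm
  · rw [hdual] at hv
    exact even_hammingNorm_of_sum_mul_self (hv v (hdual ▸ hv))
  · exact mem_rhoC_iff.2 ⟨0, hzero, 0, 1, by simp, fun j k => by simp [eCvec_idx]⟩
  · rw [hammingNorm_eq_sum_columns]
    simp only [eCvec_idx]
    decide
  · obtain ⟨c, hc, hc4⟩ := hminex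
    obtain ⟨a, ha⟩ := exists_forall_idx fun j k => phi ω (c j) k
    refine ⟨a, mem_rhoC_iff.2 ⟨c, hc, 0, 0, by simp, fun j k => by simp [ha]⟩, ?_⟩
    rw [hammingNorm_eq_sum_columns]
    simp only [ha, hammingNorm_phi]
    rw [hammingNorm_eq_sum] at hc4
    have : ∑ j, (if c j = 0 then 0 else 2) = 2 * ∑ j, if c j = 0 then 0 else 1 := by
      rw [Finset.mul_sum]
      exact Finset.sum_congr rfl fun j _ => by split_ifs <;> rfl
    omega
end

section
/- The code E_10, the 𝔽₄-span of the five vectors (1,1,1,1,0,0,0,0,0,0), (0,0,1,1,1,1,0,0,0,0), (0,0,0,0,1,1,1,1,0,0), (0,0,0,0,0,0,1,1,1,1), (1,0,1,0,1,0,1,0,ω,ϖ) in GF(4)^{10}, is a Hermitian self-dual [10,5,4] linear code over GF(4): it has 𝔽₄-dimension 5, equals its dual under the Hermitian inner product, and its minimum nonzero Hamming weight is 4. -/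
open scoped BigOperators

/-- A field with four elements has characteristic two. -/
theorem two_eq_zero_of_card_eq_four {F : Type} [Field F] [Fintype F]
    (hF : Fintype.card F = 4) : (2 : F) = 0 := by
  have h : ((4 : ℕ) : F) = 0 := by rw [← hF, Nat.cast_card_eq_zero]
  have h' : (2 : F) * 2 = 0 := by
    push_cast at h
    linear_combination h
  exact mul_self_eq_zero.mp h'

/-- The general codeword of `E10 ω`, in terms of its coefficients. -/
def E10word {F : Type} [Field F] (ω a b c d e : F) : Fin 10 → F :=
  ![a + e, a, a + b + e, a + b, b + c + e, b + c, c + d + e, c + d, d + e * ω, d + e * ω ^ 2]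

theorem mem_E10_iff {F : Type} [Field F] {ω : F} {v : Fin 10 → F} :
    v ∈ E10 ω ↔ ∃ a b c d e, v = E10word ω a b c d e := by
  have key (a b c d e : F) : a • ![1,1,1,1,0,0,0,0,0,0] + (b • ![0,0,1,1,1,1,0,0,0,0] +
      (c • ![0,0,0,0,1,1,1,1,0,0] + (d • ![0,0,0,0,0,0,1,1,1,1] +
        e • ![1,0,1,0,1,0,1,0,ω,ω^2]))) = E10word ω a b c d e := by
    ext i
    fin_cases i <;> simp [E10word] <;> ring
  simp only [E10, Submodule.mem_span_insert, Submodule.mem_span_singleton]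
  constructor
  · rintro ⟨a, _, ⟨b, _, ⟨c, _, ⟨d, _, ⟨e, rfl⟩, rfl⟩, rfl⟩, rfl⟩, rfl⟩
    exact ⟨a, b, c, d, e, key a b c d e⟩
  · rintro ⟨a, b, c, d, e, rfl⟩
    exact ⟨a, _, ⟨b, _, ⟨c, _, ⟨d, _, ⟨e, rfl⟩, rfl⟩, rfl⟩, rfl⟩, (key a b c d e).symm⟩

theorem finrank_E10 {F : Type} [Field F] (ω : F) : Module.finrank F (E10 ω) = 5 := by
  have hli : LinearIndependent F (![![1,1,1,1,0,0,0,0,0,0], ![0,0,1,1,1,1,0,0,0,0],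
      ![0,0,0,0,1,1,1,1,0,0], ![0,0,0,0,0,0,1,1,1,1],
      ![1,0,1,0,1,0,1,0,ω,ω^2]] : Fin 5 → Fin 10 → F) := by
    rw [Fintype.linearIndependent_iff]
    intro g hg
    have h0 := congrFun hg 0
    have h1 := congrFun hg 1
    have h3 := congrFun hg 3
    have h5 := congrFun hg 5
    have h7 := congrFun hg 7
    simp [Fin.sum_univ_five] at h0 h1 h3 h5 h7
    intro i
    fin_cases i <;> simp <;> grind
  rw [E10, ← Fintype.card_fin 5, ← finrank_span_eq_card hli]
  refine congrArg (fun s => Module.finrank F (Submodule.span F s)) (Set.ext fun v => ?_)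
  simp only [Set.mem_insert_iff, Set.mem_singleton_iff, Set.mem_range, Fin.exists_fin_succ,
    IsEmpty.exists_iff, eq_comm (a := v), or_false]
  rfl

theorem hammingNorm_fin_ten {F : Type} [Field F] [DecidableEq F] (v : Fin 10 → F) :
    hammingNorm v = ∑ i, if v i = 0 then 0 else 1 := by
  simp [hammingNorm, Finset.card_filter]

theorem four_le_hammingNorm_E10word {F : Type} [Field F] [DecidableEq F] {ω : F}
    (h2 : (2 : F) = 0) {a b c d e : F}
    (hv : E10word ω a b c d e ≠ 0) : 4 ≤ hammingNorm (E10word ω a b c d e) := by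
  have hw : hammingNorm (E10word ω a b c d e) =
      (if a + e = 0 then 0 else 1) + (if a = 0 then 0 else 1) +
      (if a + b + e = 0 then 0 else 1) + (if a + b = 0 then 0 else 1) +
      (if b + c + e = 0 then 0 else 1) + (if b + c = 0 then 0 else 1) +
      (if c + d + e = 0 then 0 else 1) + (if c + d = 0 then 0 else 1) +
      (if d + e * ω = 0 then 0 else 1) + (if d + e * ω ^ 2 = 0 then 0 else 1) := by
    rw [hammingNorm_fin_ten, Fin.sum_univ_castSucc, Fin.sum_univ_castSucc, Fin.sum_univ_eight]
    rfl
  rw [hw]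
  by_cases he : e = 0
  · subst he
    have hsum : a + (a + b) + (b + c) + (c + d) + d = 0 := by
      linear_combination (a + b + c + d) * h2
    have hne : ¬ (a = 0 ∧ a + b = 0 ∧ b + c = 0 ∧ c + d = 0 ∧ d = 0) := by
      rintro ⟨h0, h1, h2, h3, h4⟩
      obtain rfl : a = 0 := h0
      obtain rfl : b = 0 := by simpa using h1
      obtain rfl : c = 0 := by simpa using h2
      subst h4
      apply hv
      ext i
      fin_cases i <;> simp [E10word]
    simp only [add_zero, zero_mul]
    generalize a + b = p at *
    generalize b + c = q at *
    generalize c + d = r at *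
    split_ifs <;> simp_all
  · have pair (x y : F) (h : x - y = e) :
        1 ≤ (if x = 0 then 0 else 1) + (if y = 0 then 0 else 1) := by
      split_ifs with hx hy <;> simp_all
    have p1 := pair (a + e) a (by ring)
    have p2 := pair (a + b + e) (a + b) (by ring)
    have p3 := pair (b + c + e) (b + c) (by ring)
    have p4 := pair (c + d + e) (c + d) (by ring)
    omega

theorem E10_eq_hermDual {F : Type} [Field F] {ω : F}
    (h2 : (2 : F) = 0) (hω : ω ^ 2 = ω + 1) :
    (E10 ω : Set (Fin 10 → F)) = hermDual (E10 ω : Set (Fin 10 → F)) := by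
  ext x
  simp only [SetLike.mem_coe, hermDual, Set.mem_ofPred_eq]
  constructor
  · intro hx y hy
    obtain ⟨a, b, c, d, e, rfl⟩ := mem_E10_iff.mp hx
    obtain ⟨a', b', c', d', e', rfl⟩ := mem_E10_iff.mp hy
    simp only [Fin.sum_univ_succ, Fin.sum_univ_zero]
    simp only [E10word, Fin.isValue, Matrix.cons_val_zero, Matrix.cons_val_succ, add_zero]
    grind
  · intro hx
    have key (a b c d e : F) := hx _ (mem_E10_iff.mpr ⟨a, b, c, d, e, rfl⟩)
    simp only [Fin.sum_univ_succ, Fin.sum_univ_zero] at key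
    simp only [E10word, Fin.isValue, Matrix.cons_val_zero, Matrix.cons_val_succ, add_zero] at key
    have k1 := key 1 0 0 0 0
    have k2 := key 0 1 0 0 0
    have k3 := key 0 0 1 0 0
    have k4 := key 0 0 0 1 0
    have k5 := key 0 0 0 0 1
    simp at k1 k2 k3 k4 k5
    refine mem_E10_iff.mpr ⟨x 1, x 1 + x 3, x 1 + x 3 + x 5, x 1 + x 3 + x 5 + x 7,
      x 0 + x 1, ?_⟩
    ext i
    fin_cases i <;> simp [E10word] <;> grind

/-- E₁₀ is a Hermitian self-dual [10,5,4] linear code over GF(4). -/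
theorem stmt_4 (F : Type) [Field F] [Fintype F] [DecidableEq F]
    (hF : Fintype.card F = 4) (ω : F) (hω : ω ^ 2 = ω + 1) :
    Module.finrank F ↥(E10 ω) = 5 ∧
    (E10 ω : Set (Fin 10 → F)) = hermDual (E10 ω : Set (Fin 10 → F)) ∧
    (∀ v ∈ E10 ω, v ≠ 0 → 4 ≤ hammingNorm v) ∧
    (∃ v ∈ E10 ω, hammingNorm v = 4) := by
  have h2 := two_eq_zero_of_card_eq_four hF
  refine ⟨finrank_E10 ω, E10_eq_hermDual h2 hω, ?_, ?_⟩
  · intro v hv hv0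
    obtain ⟨a, b, c, d, e, rfl⟩ := mem_E10_iff.mp hv
    exact four_le_hammingNorm_E10word h2 hv0
  · refine ⟨![1,1,1,1,0,0,0,0,0,0], Submodule.subset_span (by simp), ?_⟩
    rw [hammingNorm_fin_ten]
    simp [Fin.sum_univ_succ]
end
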